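/- Let X be a frame which is also a supported Hilbert B-module, i.e. a Hilbert B-module whose lattice is a frame and which satisfies ⟨x,x⟩•x = x for all x ∈ X. Then the map ς : X → B defined by ς(x) = ⟨x,x⟩ is monotone, equivariant (ς(b•x) = b ⊓ ς(x) for all b, x), and left adjoint to the frame homomorphism b ↦ b•⊤; hence X is an open B-locale with support ς. -/

import Mathlib

/-- A map between complete lattices which preserves arbitrary suprema is monotone. -/
theorem monotone_of_map_sSup_eq_biSup {α β : Type*} [CompleteLattice α] [CompleteLattice β]
    {f : α → β} (hf : ∀ S : Set α, f (sSup S) = ⨆ a ∈ S, f a) : Monotone f := by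
  intro a b hab
  have h := hf {a, b}
  rw [sSup_pair, sup_eq_right.2 hab, iSup_pair] at h
  exact h ▸ le_sup_left

/-- a frame which is a supported Hilbert `B`-module is an open
`B`-locale with support `ς x = ⟨x,x⟩`: the map `ς` is monotone, equivariant,
and left adjoint to the frame homomorphism `b ↦ b • ⊤`. -/
theorem sheaves_as_modules_stmt6 {B X : Type*} [Order.Frame B] [Order.Frame X]
    (smul : B → X → X) (inn : X → X → B)
    (h1 : ∀ x : X, smul ⊤ x = x)
    (h2 : ∀ (a b : B) (x : X), smul (a ⊓ b) x = smul a (smul b x))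
    (h3 : ∀ (S : Set B) (x : X), smul (sSup S) x = ⨆ b ∈ S, smul b x)
    (h4 : ∀ (b : B) (T : Set X), smul b (sSup T) = ⨆ x ∈ T, smul b x)
    (hi1 : ∀ (b : B) (x y : X), inn (smul b x) y = b ⊓ inn x y)
    (hi2 : ∀ (T : Set X) (y : X), inn (sSup T) y = ⨆ x ∈ T, inn x y)
    (hi3 : ∀ x y : X, inn x y = inn y x)
    (hnd : ∀ x y : X, (∀ z : X, inn x z = inn y z) → x = y)
    (hsupp : ∀ x : X, smul (inn x x) x = x) :
    -- ς x = ⟨x,x⟩ is monotone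
    Monotone (fun x : X => inn x x) ∧
    -- ς is equivariant
    (∀ (b : B) (x : X), inn (smul b x) (smul b x) = b ⊓ inn x x) ∧
    -- b ↦ b • ⊤ is a frame homomorphism
    (∀ S : Set B, smul (sSup S) (⊤ : X) = ⨆ b ∈ S, smul b ⊤) ∧
    (∀ a b : B, smul (a ⊓ b) (⊤ : X) = smul a ⊤ ⊓ smul b ⊤) ∧
    smul ⊤ (⊤ : X) = ⊤ ∧
    -- ς is left adjoint to b ↦ b • ⊤, so X is an open B-locale with support ς
    (∀ (x : X) (b : B), inn x x ≤ b ↔ x ≤ smul b ⊤) := by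
  have smul_mono_left (x : X) : Monotone fun b => smul b x :=
    monotone_of_map_sSup_eq_biSup fun S => h3 S x
  have smul_mono_right (b : B) : Monotone (smul b) := monotone_of_map_sSup_eq_biSup (h4 b)
  have inn_mono_left (y : X) : Monotone fun x => inn x y :=
    monotone_of_map_sSup_eq_biSup fun T => hi2 T y
  have inn_mono_right (x : X) : Monotone (inn x) := by
    intro y z hyz
    rw [hi3 x y, hi3 x z]
    exact inn_mono_left x hyz
  have adj (x : X) (b : B) : inn x x ≤ b ↔ x ≤ smul b ⊤ := by
    constructor
    · intro h
      calc x = smul (inn x x) x := (hsupp x).symm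
        _ ≤ smul b x := smul_mono_left x h
        _ ≤ smul b ⊤ := smul_mono_right b le_top
    · intro h
      calc inn x x ≤ inn (smul b ⊤) x := inn_mono_left x h
        _ = b ⊓ inn ⊤ x := hi1 b ⊤ x
        _ ≤ b := inf_le_left
  refine ⟨fun x y hxy => (inn_mono_left x hxy).trans (inn_mono_right y hxy), fun b x => ?_,
    fun S => h3 S ⊤, fun a b => le_antisymm ?_ ?_, h1 ⊤, adj⟩
  · rw [hi1, hi3, hi1, ← inf_assoc, inf_idem]
  · exact le_inf (smul_mono_left ⊤ inf_le_left) (smul_mono_left ⊤ inf_le_right)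
  · exact (adj _ _).1 (le_inf ((adj _ _).2 inf_le_left) ((adj _ _).2 inf_le_right))
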